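/- Let λ ≥ 0 and let Z be a random variable with the Poisson distribution of parameter λ. Then for every n ∈ ℕ, E[Z^n] = ∑_{k=0}^n λ^k · S(n,k) = B_n(λ), where S(n,k) denotes the Stirling number of the second kind and B_n is the Bell polynomial of order n. -/

import Mathlib

open MeasureTheory Finset

/-- Stirling number of the second kind: the number of partitions of a set of `n`
elements into `k` non-empty subsets. -/
noncomputable def stirling2 (n k : ℕ) : ℕ :=
  Nat.card {P : Finpartition (Finset.univ : Finset (Fin n)) // P.parts.card = k}

/-- The Bell polynomial of order `n`. -/
noncomputable def bellPoly (n : ℕ) (x : ℝ) : ℝ :=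
  ∑ k ∈ Finset.range (n + 1), x ^ k * stirling2 n k

namespace Finpartition

variable {α β : Type*} [Fintype α] [DecidableEq α]

lemma eq_of_part_eq {P Q : Finpartition (univ : Finset α)} (h : ∀ a, P.part a = Q.part a) :
    P = Q := by
  have parts_eq (R : Finpartition (univ : Finset α)) : R.parts = univ.image R.part := by
    ext t
    simp only [Finset.mem_image, mem_univ, true_and]
    constructor
    · intro ht
      obtain ⟨a, ha⟩ := R.nonempty_of_mem_parts ht
      exact ⟨a, R.part_eq_of_mem ht ha⟩
    · rintro ⟨a, rfl⟩
      simp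
  ext1
  rw [parts_eq P, parts_eq Q, funext h]

/-- The function that is constant on the parts of a finpartition, with values prescribed by an
embedding of the set of parts. -/
def sigmaEmbeddingToFun (x : Σ P : Finpartition (univ : Finset α), (P.parts ↪ β)) (a : α) : β :=
  x.2 ⟨x.1.part a, x.1.part_mem.2 (mem_univ a)⟩

lemma mem_part_iff_sigmaEmbeddingToFun_eq
    (x : Σ P : Finpartition (univ : Finset α), (P.parts ↪ β)) (a b : α) :
    a ∈ x.1.part b ↔ sigmaEmbeddingToFun x a = sigmaEmbeddingToFun x b := by
  simp [sigmaEmbeddingToFun, x.1.mem_part_iff_part_eq_part (mem_univ a) (mem_univ b)]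

lemma sigmaEmbeddingToFun_bijective :
    Function.Bijective (sigmaEmbeddingToFun (α := α) (β := β)) := by
  classical
  constructor
  · intro x y h
    have hP : x.1 = y.1 := eq_of_part_eq fun b ↦ by
      ext a
      rw [mem_part_iff_sigmaEmbeddingToFun_eq, mem_part_iff_sigmaEmbeddingToFun_eq, h]
    obtain ⟨P, e⟩ := x
    obtain ⟨Q, e'⟩ := y
    obtain rfl : P = Q := hP
    congr 1
    ext ⟨t, ht⟩
    obtain ⟨a, ha⟩ := P.nonempty_of_mem_parts ht
    obtain rfl := P.part_eq_of_mem ht ha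
    exact congrFun h a
  · intro f
    let P := ofSetoid (Setoid.ker f)
    have mem_part (a b : α) : b ∈ P.part a ↔ f a = f b := mem_part_ofSetoid_iff_rel
    choose r hr using fun t : P.parts ↦ P.nonempty_of_mem_parts t.2
    have hr' (t : P.parts) : P.part (r t) = t := P.part_eq_of_mem t.2 (hr t)
    refine ⟨⟨P, ⟨fun t ↦ f (r t), fun s t h ↦ Subtype.ext ?_⟩⟩, funext fun a ↦ ?_⟩
    · rw [← hr' s, ← hr' t, ← P.mem_part_iff_part_eq_part (mem_univ _) (mem_univ _), mem_part]
      exact h.symm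
    · exact ((mem_part _ _).1 (hr ⟨P.part a, _⟩)).symm

end Finpartition

/-- Powers expand in descending factorials with Stirling numbers as coefficients. -/
lemma pow_eq_sum_stirling2_mul_descFactorial (m n : ℕ) :
    m ^ n = ∑ k ∈ range (n + 1), stirling2 n k * m.descFactorial k := by
  classical
  calc
    m ^ n = Fintype.card (Fin n → Fin m) := by simp
    _ = ∑ P : Finpartition (univ : Finset (Fin n)), m.descFactorial #P.parts := by
      rw [← Fintype.card_of_bijective Finpartition.sigmaEmbeddingToFun_bijective,
        Fintype.card_sigma]
      simp [Fintype.card_embedding_eq]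
    _ = ∑ k ∈ range (n + 1), ∑ P : Finpartition (univ : Finset (Fin n)) with #P.parts = k,
        m.descFactorial #P.parts := by
      refine (sum_fiberwise_of_maps_to (fun P _ ↦ ?_) _).symm
      simpa [Nat.lt_succ_iff] using P.card_parts_le_card
    _ = ∑ k ∈ range (n + 1), stirling2 n k * m.descFactorial k := by
      refine sum_congr rfl fun k _ ↦ ?_
      rw [sum_congr rfl fun P hP ↦ by rw [(mem_filter.1 hP).2], sum_const, smul_eq_mul, stirling2,
        Nat.card_eq_fintype_card, Fintype.card_subtype]

/-- The `k`-th factorial moment of the Poisson distribution. -/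
lemma hasSum_poisson_mul_descFactorial (r : ℝ) (k : ℕ) :
    HasSum (fun m : ℕ ↦ Real.exp (-r) * r ^ m / m.factorial * m.descFactorial k) (r ^ k) := by
  have h := (NormedSpace.expSeries_div_hasSum_exp r).mul_left (Real.exp (-r) * r ^ k)
  rw [← Real.exp_eq_exp_ℝ, mul_right_comm, ← Real.exp_add, neg_add_cancel, Real.exp_zero,
    one_mul] at h
  rw [← hasSum_nat_add_iff' k, sum_eq_zero, sub_zero]
  · refine h.congr_fun fun m ↦ ?_
    have hfac := Nat.factorial_mul_descFactorial (Nat.le_add_left k m)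
    rw [Nat.add_sub_cancel] at hfac
    rw [← hfac]
    have : ((m + k).descFactorial k : ℝ) ≠ 0 := by
      simp [Nat.descFactorial_eq_zero_iff_lt]
    push_cast
    field_simp
    ring
  · intro m hm
    simp [Nat.descFactorial_eq_zero_iff_lt.2 (mem_range.1 hm)]

lemma integral_pow_poissonMeasure (r : NNReal) (n : ℕ) :
    ∫ m, (m : ℝ) ^ n ∂ProbabilityTheory.poissonMeasure r = bellPoly n r := by
  rw [ProbabilityTheory.integral_poissonMeasure]
  refine HasSum.tsum_eq ?_
  have h := hasSum_sum fun k (_ : k ∈ range (n + 1)) ↦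
    (hasSum_poisson_mul_descFactorial r k).mul_right (stirling2 n k : ℝ)
  refine h.congr_fun fun m ↦ ?_
  have hpow := congrArg (Nat.cast (R := ℝ)) (pow_eq_sum_stirling2_mul_descFactorial m n)
  push_cast at hpow
  rw [hpow, smul_eq_mul, mul_sum]
  exact sum_congr rfl fun k _ ↦ by ring

theorem stmt2 {Ω : Type*} [MeasurableSpace Ω] (μ : Measure Ω) [IsProbabilityMeasure μ]
    (lam : ℝ) (hlam : 0 ≤ lam) (Z : Ω → ℕ) (hZ : Measurable Z)
    (hdist : ∀ m : ℕ, μ {ω | Z ω = m} =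
      ENNReal.ofReal (Real.exp (-lam) * lam ^ m / Nat.factorial m))
    (n : ℕ) :
    (∫ ω, (Z ω : ℝ) ^ n ∂μ = ∑ k ∈ Finset.range (n + 1), lam ^ k * (stirling2 n k : ℝ)) ∧
      ∫ ω, (Z ω : ℝ) ^ n ∂μ = bellPoly n lam := by
  lift lam to NNReal using hlam
  have hmap : μ.map Z = ProbabilityTheory.poissonMeasure lam := by
    refine Measure.ext_of_singleton fun m ↦ ?_
    rw [Measure.map_apply hZ (measurableSet_singleton m),
      ProbabilityTheory.poissonMeasure_singleton, ← hdist m]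
    rfl
  have h : ∫ ω, (Z ω : ℝ) ^ n ∂μ = bellPoly n lam := by
    rw [← integral_pow_poissonMeasure, ← hmap, integral_map hZ.aemeasurable .of_discrete]
  exact ⟨h, h⟩
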